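/- Let n ≥ 1 and m ≥ 2 be integers, and let B_1, …, B_m be symmetric real n×n matrices. For matrices C, D set ⟨C,D⟩ = trace(Cᵀ D) and N(C) = ⟨C,C⟩, and put S_{jk} = trace(B_j B_k), S_j = S_{jj}, S = S_1 + ⋯ + S_m. Then Σ_{j,k=1}^m N(B_j B_k − B_k B_j) + Σ_{j,k=1}^m S_{jk}² ≤ (3/2) S². -/

import Mathlib

open Matrix BigOperators

/-- Layer-cake argument for quadratic forms on the nonnegative orthant. -/
theorem layer_aux {m : ℕ} (M : Fin m → Fin m → ℝ) (hM : ∀ i j, M i j = M j i)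
    (h : ∀ x : Fin m → ℝ, (∀ i, 0 ≤ x i) → ∀ j, (∀ k, x k ≤ x j) → ∑ k, M j k * x k ≤ 0)
    (N : ℕ) : ∀ x : Fin m → ℝ, (∀ i, 0 ≤ x i) → (Finset.univ.image x).card ≤ N →
      ∑ j, x j * ∑ k, M j k * x k ≤ 0 := by
  induction N with
  | zero =>
    intro x hx hc
    have : (Finset.univ : Finset (Fin m)) = ∅ := by
      have := Finset.card_eq_zero.mp (Nat.le_zero.mp hc)
      simpa using this
    rw [this]; simp
  | succ N ih =>
    intro x hx hc
    by_cases hne : (Finset.univ.image x).Nonempty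
    swap
    · have : (Finset.univ : Finset (Fin m)) = ∅ := by
        simpa [Finset.not_nonempty_iff_eq_empty] using hne
      rw [this]; simp
    obtain ⟨j0, -, hj0⟩ := Finset.mem_image.mp (Finset.max'_mem _ hne)
    have hmax : ∀ k, x k ≤ x j0 := fun k => by
      rw [hj0]; exact Finset.le_max' _ _ (Finset.mem_image_of_mem _ (Finset.mem_univ _))
    by_cases hne2 : ((Finset.univ.image x).erase (x j0)).Nonempty
    swap
    · have hall : ∀ j, x j = x j0 := by
        intro j
        by_contra hj
        exact hne2 ⟨x j, Finset.mem_erase.mpr ⟨hj, Finset.mem_image_of_mem _ (Finset.mem_univ _)⟩⟩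
      apply Finset.sum_nonpos
      intro j _
      exact mul_nonpos_of_nonneg_of_nonpos (hx j)
        (h x hx j (fun k => by rw [hall j]; exact hmax k))
    obtain ⟨s, hs⟩ : ∃ s, s = ((Finset.univ.image x).erase (x j0)).max' hne2 := ⟨_, rfl⟩
    have hsm := Finset.max'_mem _ hne2
    rw [← hs] at hsm
    obtain ⟨hs1, hs2⟩ := Finset.mem_erase.mp hsm
    obtain ⟨j1, -, hj1⟩ := Finset.mem_image.mp hs2
    have hsle : s ≤ x j0 := hj1 ▸ hmax j1
    have hdich : ∀ k, x k = x j0 ∨ x k ≤ s := by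
      intro k
      by_cases hk : x k = x j0
      · exact Or.inl hk
      · right
        rw [hs]
        exact Finset.le_max' _ _
          (Finset.mem_erase.mpr ⟨hk, Finset.mem_image_of_mem _ (Finset.mem_univ _)⟩)
    let z : Fin m → ℝ := fun k => min (x k) s
    have hs0 : 0 ≤ s := hj1 ▸ hx j1
    have hz0 : ∀ i, 0 ≤ z i := fun i => le_min (hx i) hs0
    have hzc : (Finset.univ.image z).card ≤ N := by
      have hsub : Finset.univ.image z ⊆ (Finset.univ.image x).erase (x j0) := by
        intro y hy
        obtain ⟨k, -, rfl⟩ := Finset.mem_image.mp hy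
        rcases hdich k with hk | hk
        · have : z k = s := min_eq_right (by rw [hk]; exact hsle)
          rw [this]; exact hsm
        · by_cases hk2 : x k = x j0
          · have : z k = s := min_eq_right (by rw [hk2]; exact hsle)
            rw [this]; exact hsm
          · have : z k = x k := min_eq_left hk
            rw [this]
            exact Finset.mem_erase.mpr ⟨hk2, Finset.mem_image_of_mem _ (Finset.mem_univ _)⟩
      have h1 := Finset.card_le_card hsub
      rw [Finset.card_erase_of_mem (Finset.mem_image_of_mem _ (Finset.mem_univ _))] at h1
      omega
    have hz := ih z hz0 hzc
    have hsymm : ∑ j, x j * ∑ k, M j k * z k = ∑ j, z j * ∑ k, M j k * x k := by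
      simp only [Finset.mul_sum]
      rw [Finset.sum_comm]
      refine Finset.sum_congr rfl fun i _ => Finset.sum_congr rfl fun j _ => ?_
      rw [hM j i]; ring
    have hdiff : ∑ j, (x j - z j) * ∑ k, M j k * (x k + z k) ≤ 0 := by
      apply Finset.sum_nonpos
      intro j _
      have hzx : z j ≤ x j := min_le_left _ _
      rcases hdich j with hj | hj
      · refine mul_nonpos_of_nonneg_of_nonpos (by linarith) ?_
        refine h (fun k => x k + z k) (fun k => add_nonneg (hx k) (hz0 k)) j (fun k => ?_)
        have h1 : x k ≤ x j := hj ▸ hmax k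
        exact add_le_add h1 (min_le_min_right _ h1)
      · have : z j = x j := min_eq_left hj
        rw [this]; simp
    have hexp : ∑ j, (x j - z j) * ∑ k, M j k * (x k + z k)
        = ∑ j, x j * ∑ k, M j k * x k + ∑ j, x j * ∑ k, M j k * z k
          - ∑ j, z j * ∑ k, M j k * x k - ∑ j, z j * ∑ k, M j k * z k := by
      rw [← Finset.sum_add_distrib, ← Finset.sum_sub_distrib, ← Finset.sum_sub_distrib]
      refine Finset.sum_congr rfl fun j _ => ?_
      simp only [mul_add, Finset.sum_add_distrib]
      ring
    linarith

theorem ker_bound {n : ℕ} (a b c d : Fin n) (hab : a ≠ b) (hcd : c ≠ d) :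
    |∑ i, ((if i = a then (1:ℝ) else 0) - (if i = b then 1 else 0)) *
      ((if i = c then (1:ℝ) else 0) - (if i = d then 1 else 0))|
      ≤ 1 + (if (a, b) = (c, d) then 1 else 0) + (if (a, b) = (d, c) then 1 else 0) := by
  have : ∑ i, ((if i = a then (1:ℝ) else 0) - (if i = b then 1 else 0)) *
      ((if i = c then (1:ℝ) else 0) - (if i = d then 1 else 0))
      = ((if a = c then (1:ℝ) else 0) - (if a = d then 1 else 0))
        - ((if b = c then (1:ℝ) else 0) - (if b = d then 1 else 0)) := by
    simp only [sub_mul, Finset.sum_sub_distrib, ite_mul, one_mul, zero_mul]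
    simp
  rw [this]
  simp only [Prod.mk.injEq]
  by_cases h1 : a = c <;> by_cases h2 : a = d <;> by_cases h3 : b = c <;> by_cases h4 : b = d <;>
    simp_all <;> norm_num

theorem edge_bound {n : ℕ} (l : Fin n → ℝ) (E : Finset (Fin n × Fin n))
    (hE : ∀ e ∈ E, e.1 ≠ e.2) (hl : ∑ i, l i ^ 2 ≤ 1) :
    ∑ e ∈ E, (l e.1 - l e.2) ^ 2 ≤ E.card + 2 := by
  let d : Fin n × Fin n → Fin n → ℝ := fun e i =>
    (if i = e.1 then (1:ℝ) else 0) - (if i = e.2 then 1 else 0)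
  let y : Fin n × Fin n → ℝ := fun e => l e.1 - l e.2
  have hy : ∀ e, y e = ∑ i, l i * d e i := by
    intro e; simp [y, d, mul_sub, Finset.sum_sub_distrib]
  let Y := ∑ e ∈ E, y e ^ 2
  let v : Fin n → ℝ := fun i => ∑ e ∈ E, y e * d e i
  have hY0 : 0 ≤ Y := Finset.sum_nonneg fun _ _ => sq_nonneg _
  have hYv : Y = ∑ i, l i * v i := by
    simp only [Y, v, Finset.mul_sum]
    rw [Finset.sum_comm]
    refine Finset.sum_congr rfl fun e _ => ?_
    rw [pow_two]; nth_rewrite 2 [hy e]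
    rw [Finset.mul_sum]
    refine Finset.sum_congr rfl fun i _ => by ring
  have hv : ∑ i, v i ^ 2 ≤ (E.card + 2) * Y := by
    have h1 : ∑ i, v i ^ 2 = ∑ e ∈ E, ∑ f ∈ E, y e * y f * ∑ i, d e i * d f i := by
      simp only [v, pow_two, Finset.sum_mul_sum]
      simp only [Finset.mul_sum]
      rw [Finset.sum_comm]
      refine Finset.sum_congr rfl fun e _ => ?_
      rw [Finset.sum_comm]
      refine Finset.sum_congr rfl fun f _ => Finset.sum_congr rfl fun i _ => by ring
    let K : Fin n × Fin n → Fin n × Fin n → ℝ := fun e f =>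
      1 + (if e = f then 1 else 0) + (if e = (f.2, f.1) then 1 else 0)
    have hKs : ∀ e f, K e f = K f e := by
      rintro ⟨a, b⟩ ⟨c, d⟩
      simp only [K, Prod.mk.injEq]
      congr 1
      · congr 2; simp only [eq_comm]
      · congr 1; rw [and_comm]; simp only [eq_comm]
    have hrow : ∀ e, ∑ f ∈ E, K e f ≤ E.card + 2 := by
      intro e
      simp only [K, Finset.sum_add_distrib]
      have a1 : ∑ f ∈ E, (if e = f then (1:ℝ) else 0) ≤ 1 := by
        rw [Finset.sum_ite_eq]; split_ifs <;> norm_num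
      have a2 : ∑ f ∈ E, (if e = (f.2, f.1) then (1:ℝ) else 0) ≤ 1 := by
        have : ∀ f : Fin n × Fin n, (e = (f.2, f.1)) ↔ ((e.2, e.1) = f) := by
          rintro ⟨a, b⟩; rcases e with ⟨c, d⟩; simp only [Prod.mk.injEq]; exact and_comm
        simp only [this]
        rw [Finset.sum_ite_eq]; split_ifs <;> norm_num
      simp only [Finset.sum_const, nsmul_eq_mul, mul_one]
      linarith
    have h2 : ∀ e ∈ E, ∀ f ∈ E, y e * y f * ∑ i, d e i * d f i
        ≤ y e ^ 2 / 2 * K e f + y f ^ 2 / 2 * K f e := by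
      intro e he f hf
      have hk := ker_bound e.1 e.2 f.1 f.2 (hE e he) (hE f hf)
      change |∑ i, d e i * d f i| ≤ K e f at hk
      rw [hKs f e]
      have hK0 := (abs_nonneg _).trans hk
      calc _ ≤ |y e * y f * ∑ i, d e i * d f i| := le_abs_self _
        _ = |y e * y f| * |∑ i, d e i * d f i| := abs_mul _ _
        _ ≤ (y e ^ 2 / 2 + y f ^ 2 / 2) * K e f := by
          apply mul_le_mul _ hk (abs_nonneg _) (by positivity)
          rw [abs_le]
          constructor <;> nlinarith [sq_nonneg (y e - y f), sq_nonneg (y e + y f)]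
        _ = _ := by ring
    have h3 : ∑ e ∈ E, ∑ f ∈ E, y e ^ 2 / 2 * K e f ≤ (E.card + 2) * Y / 2 := by
      have : (E.card + 2) * Y / 2 = ∑ e ∈ E, y e ^ 2 / 2 * (E.card + 2) := by
        rw [← Finset.sum_mul, ← Finset.sum_div]; ring
      rw [this]
      apply Finset.sum_le_sum
      intro e _
      rw [← Finset.mul_sum]
      exact mul_le_mul_of_nonneg_left (hrow e) (by positivity)
    rw [h1]
    calc _ ≤ ∑ e ∈ E, ∑ f ∈ E, (y e ^ 2 / 2 * K e f + y f ^ 2 / 2 * K f e) :=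
          Finset.sum_le_sum fun e he => Finset.sum_le_sum fun f hf => h2 e he f hf
      _ = ∑ e ∈ E, ∑ f ∈ E, y e ^ 2 / 2 * K e f + ∑ f ∈ E, ∑ e ∈ E, y f ^ 2 / 2 * K f e := by
          simp only [Finset.sum_add_distrib]
          congr 1
          exact Finset.sum_comm
      _ ≤ _ := by linarith
  have hcs := Finset.sum_mul_sq_le_sq_mul_sq Finset.univ l v
  rw [← hYv] at hcs
  have hv0 : 0 ≤ ∑ i, v i ^ 2 := Finset.sum_nonneg fun _ _ => sq_nonneg _
  have : Y ^ 2 ≤ (E.card + 2) * Y := by nlinarith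
  change Y ≤ _
  rcases hY0.eq_or_lt with h0 | h0
  · rw [← h0]; exact add_nonneg (Nat.cast_nonneg _) (by norm_num)
  · by_contra hcon
    push Not at hcon
    nlinarith

/-- Frobenius inner product. -/
def ip {n : ℕ} (A B : Matrix (Fin n) (Fin n) ℝ) : ℝ := ∑ i, ∑ j, A i j * B i j

theorem bessel_entry {n m : ℕ} (s : Finset (Fin m)) (C : Fin m → Matrix (Fin n) (Fin n) ℝ)
    (hs : ∀ k, (C k)ᵀ = C k) (horth : ∀ j k, j ≠ k → ip (C j) (C k) = 0)
    (hnorm : ∀ j, ip (C j) (C j) ≤ 1) (a b : Fin n) (hab : a ≠ b) :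
    ∑ k ∈ s, (C k a b) ^ 2 ≤ 1 / 2 := by
  let e : Matrix (Fin n) (Fin n) ℝ := fun i j =>
    (if i = a then if j = b then 1/2 else 0 else 0) + (if i = b then if j = a then 1/2 else 0 else 0)
  let D : Matrix (Fin n) (Fin n) ℝ := fun i j => ∑ k ∈ s, C k a b * C k i j
  have h0 : 0 ≤ ∑ i, ∑ j, (e i j - D i j) ^ 2 :=
    Finset.sum_nonneg fun _ _ => Finset.sum_nonneg fun _ _ => sq_nonneg _
  have hba : ∀ k, C k b a = C k a b := fun k => by
    conv_lhs => rw [← hs k]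
    rfl
  have hip : ∀ X : Matrix (Fin n) (Fin n) ℝ, ∑ i, ∑ j, e i j * X i j = (X a b + X b a) / 2 := by
    intro X
    simp only [e, add_mul, Finset.sum_add_distrib, ite_mul, zero_mul]
    simp
    ring
  have hee : ∑ i, ∑ j, e i j * e i j = 1 / 2 := by
    rw [hip]; simp [e, hab, hab.symm]
  have heD : ∑ i, ∑ j, e i j * D i j = ∑ k ∈ s, (C k a b) ^ 2 := by
    rw [hip]; simp only [D, hba, pow_two]; ring
  have hDD : ∑ i, ∑ j, D i j * D i j ≤ ∑ k ∈ s, (C k a b) ^ 2 := by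
    have : ∑ i, ∑ j, D i j * D i j
        = ∑ k ∈ s, ∑ l ∈ s, C k a b * C l a b * ip (C k) (C l) := by
      simp only [D, Finset.sum_mul_sum, ip]
      simp only [Finset.mul_sum]
      simp_rw [Finset.sum_comm (s := Finset.univ) (t := s)]
      refine Finset.sum_congr rfl fun e _ => Finset.sum_congr rfl fun e _ =>
        Finset.sum_congr rfl fun e _ => Finset.sum_congr rfl fun e _ => by ring
    rw [this]
    apply Finset.sum_le_sum
    intro k hk
    rw [Finset.sum_eq_single_of_mem k hk (fun l _ hl => by rw [horth k l hl.symm, mul_zero])]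
    nlinarith [hnorm k, sq_nonneg (C k a b)]
  have hexp : ∑ i, ∑ j, (e i j - D i j) ^ 2 = ∑ i, ∑ j, e i j * e i j
      - 2 * ∑ i, ∑ j, e i j * D i j + ∑ i, ∑ j, D i j * D i j := by
    simp only [Finset.mul_sum, ← Finset.sum_add_distrib, ← Finset.sum_sub_distrib]
    refine Finset.sum_congr rfl fun i _ => Finset.sum_congr rfl fun j _ => by ring
  linarith

theorem lu_diag {n m : ℕ} (s : Finset (Fin m)) (l : Fin n → ℝ) (hl : ∑ i, l i ^ 2 ≤ 1)
    (C : Fin m → Matrix (Fin n) (Fin n) ℝ)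
    (hs : ∀ k, (C k)ᵀ = C k) (horth : ∀ j k, j ≠ k → ip (C j) (C k) = 0)
    (hnorm : ∀ j, ip (C j) (C j) ≤ 1) (x : Fin m → ℝ) (c : ℝ)
    (hx : ∀ k ∈ s, 0 ≤ x k) (hc : ∀ k ∈ s, x k ≤ c) (hc0 : 0 ≤ c) :
    ∑ k ∈ s, x k * ∑ i, ∑ j, ((l i - l j) * C k i j) ^ 2 ≤ ∑ k ∈ s, x k + c := by
  classical
  let E : Finset (Fin n × Fin n) := Finset.univ.filter fun e => 1 < (l e.1 - l e.2) ^ 2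
  have hE : ∀ e ∈ E, e.1 ≠ e.2 := by
    intro e he h
    have := (Finset.mem_filter.mp he).2
    rw [h] at this; norm_num at this
  have hb := edge_bound l E hE hl
  have hb2 : ∑ e ∈ E, ((l e.1 - l e.2) ^ 2 - 1) ≤ 2 := by
    rw [Finset.sum_sub_distrib]; simp; linarith
  have key : ∀ k ∈ s, x k * ∑ i, ∑ j, ((l i - l j) * C k i j) ^ 2
      ≤ x k + c * ∑ e ∈ E, ((l e.1 - l e.2) ^ 2 - 1) * C k e.1 e.2 ^ 2 := by
    intro k hk
    have h1 : ∑ i, ∑ j, ((l i - l j) * C k i j) ^ 2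
        = ip (C k) (C k) + ∑ e : Fin n × Fin n, ((l e.1 - l e.2) ^ 2 - 1) * C k e.1 e.2 ^ 2 := by
      rw [ip, Fintype.sum_prod_type]
      simp only [← Finset.sum_add_distrib]
      refine Finset.sum_congr rfl fun i _ => Finset.sum_congr rfl fun j _ => by ring
    have h2 : ∑ e : Fin n × Fin n, ((l e.1 - l e.2) ^ 2 - 1) * C k e.1 e.2 ^ 2
        ≤ ∑ e ∈ E, ((l e.1 - l e.2) ^ 2 - 1) * C k e.1 e.2 ^ 2 := by
      rw [Finset.sum_filter]
      apply Finset.sum_le_sum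
      intro e _
      split_ifs with h
      · exact le_rfl
      · exact mul_nonpos_of_nonpos_of_nonneg (by linarith) (sq_nonneg _)
    have h3 : 0 ≤ ∑ e ∈ E, ((l e.1 - l e.2) ^ 2 - 1) * C k e.1 e.2 ^ 2 := by
      apply Finset.sum_nonneg
      intro e he
      have := (Finset.mem_filter.mp he).2
      exact mul_nonneg (by linarith) (sq_nonneg _)
    have h4 := mul_le_mul_of_nonneg_right (hc k hk) h3
    have h5 : x k * ∑ i, ∑ j, ((l i - l j) * C k i j) ^ 2
        ≤ x k * (1 + ∑ e ∈ E, ((l e.1 - l e.2) ^ 2 - 1) * C k e.1 e.2 ^ 2) :=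
      mul_le_mul_of_nonneg_left (by rw [h1]; linarith [hnorm k]) (hx k hk)
    linarith
  have hfin : ∑ k ∈ s, ∑ e ∈ E, ((l e.1 - l e.2) ^ 2 - 1) * C k e.1 e.2 ^ 2 ≤ 1 := by
    rw [Finset.sum_comm]
    calc _ ≤ ∑ e ∈ E, ((l e.1 - l e.2) ^ 2 - 1) * (1/2) := by
          apply Finset.sum_le_sum
          intro e he
          rw [← Finset.mul_sum]
          have := (Finset.mem_filter.mp he).2
          exact mul_le_mul_of_nonneg_left (bessel_entry s C hs horth hnorm _ _ (hE e he))
            (by linarith)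
      _ ≤ 1 := by rw [← Finset.sum_mul]; linarith
  calc _ ≤ ∑ k ∈ s, (x k + c * ∑ e ∈ E, ((l e.1 - l e.2) ^ 2 - 1) * C k e.1 e.2 ^ 2) :=
        Finset.sum_le_sum key
    _ = ∑ k ∈ s, x k + c * ∑ k ∈ s, ∑ e ∈ E, ((l e.1 - l e.2) ^ 2 - 1) * C k e.1 e.2 ^ 2 := by
        rw [Finset.sum_add_distrib, ← Finset.mul_sum]
    _ ≤ _ := by nlinarith

theorem spec_aux {n : ℕ} (A : Matrix (Fin n) (Fin n) ℝ) (hA : Aᵀ = A) :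
    ∃ (U : Matrix (Fin n) (Fin n) ℝ) (d : Fin n → ℝ), Uᵀ * U = 1 ∧ U * Uᵀ = 1 ∧
      A = U * diagonal d * Uᵀ := by
  have hH : A.IsHermitian := by
    rw [Matrix.IsHermitian, conjTranspose_eq_transpose_of_trivial]; exact hA
  refine ⟨hH.eigenvectorUnitary, hH.eigenvalues, ?_, ?_, ?_⟩
  · have := Unitary.coe_star_mul_self hH.eigenvectorUnitary
    rwa [star_eq_conjTranspose, conjTranspose_eq_transpose_of_trivial] at this
  · have := Unitary.coe_mul_star_self hH.eigenvectorUnitary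
    rwa [Unitary.coe_star, star_eq_conjTranspose, conjTranspose_eq_transpose_of_trivial] at this
  · have := hH.spectral_theorem
    rw [Unitary.conjStarAlgAut_apply, star_eq_conjTranspose,
      conjTranspose_eq_transpose_of_trivial] at this
    exact this

theorem ip_eq {n : ℕ} (A B : Matrix (Fin n) (Fin n) ℝ) : ip A B = (Aᵀ * B).trace := by
  simp only [ip, Matrix.trace, Matrix.diag, Matrix.mul_apply, Matrix.transpose_apply]
  exact Finset.sum_comm

theorem ip_conj {n : ℕ} (U A B : Matrix (Fin n) (Fin n) ℝ) (hU : U * Uᵀ = 1) :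
    ip (Uᵀ * A * U) (Uᵀ * B * U) = ip A B := by
  rw [ip_eq, ip_eq]
  have : (Uᵀ * A * U)ᵀ * (Uᵀ * B * U) = Uᵀ * (Aᵀ * B * U) := by
    simp only [transpose_mul, transpose_transpose, Matrix.mul_assoc]
    rw [← Matrix.mul_assoc U Uᵀ, hU, Matrix.one_mul]
  rw [this, Matrix.trace_mul_comm, Matrix.mul_assoc, hU, Matrix.mul_one]

/-- Squared norm of the commutator. -/
def nc {n : ℕ} (A B : Matrix (Fin n) (Fin n) ℝ) : ℝ := ip (A * B - B * A) (A * B - B * A)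

theorem nc_comm {n : ℕ} (A B : Matrix (Fin n) (Fin n) ℝ) : nc A B = nc B A := by
  simp only [nc, ip, Matrix.sub_apply]
  refine Finset.sum_congr rfl fun i _ => Finset.sum_congr rfl fun j _ => by ring

theorem nc_smul {n : ℕ} (a b : ℝ) (A B : Matrix (Fin n) (Fin n) ℝ) :
    nc (a • A) (b • B) = a ^ 2 * b ^ 2 * nc A B := by
  have : (a • A) * (b • B) - (b • B) * (a • A) = (a * b) • (A * B - B * A) := by
    simp only [smul_mul_assoc, mul_smul_comm, smul_smul, smul_sub, mul_comm]
  rw [nc, this, nc]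
  simp only [ip, Matrix.smul_apply, smul_eq_mul, Finset.mul_sum]
  refine Finset.sum_congr rfl fun i _ => Finset.sum_congr rfl fun j _ => by ring

theorem lu_lemma {n m : ℕ} (s : Finset (Fin m)) (A : Matrix (Fin n) (Fin n) ℝ)
    (hA : Aᵀ = A) (hA1 : ip A A ≤ 1)
    (C : Fin m → Matrix (Fin n) (Fin n) ℝ)
    (hs : ∀ k, (C k)ᵀ = C k) (horth : ∀ j k, j ≠ k → ip (C j) (C k) = 0)
    (hnorm : ∀ j, ip (C j) (C j) ≤ 1) (x : Fin m → ℝ) (c : ℝ)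
    (hx : ∀ k ∈ s, 0 ≤ x k) (hc : ∀ k ∈ s, x k ≤ c) (hc0 : 0 ≤ c) :
    ∑ k ∈ s, x k * nc A (C k) ≤ ∑ k ∈ s, x k + c := by
  obtain ⟨U, d, hU1, hU2, hAd⟩ := spec_aux A hA
  have hD : Uᵀ * A * U = diagonal d := by
    rw [hAd]
    simp only [Matrix.mul_assoc]
    rw [hU1, Matrix.mul_one, ← Matrix.mul_assoc, hU1, Matrix.one_mul]
  have hd : ∑ i, d i ^ 2 ≤ 1 := by
    have h1 := ip_conj U A A hU2
    rw [hD] at h1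
    have h2 : ip (diagonal d) (diagonal d) = ∑ i, d i ^ 2 := by
      simp only [ip, diagonal_apply]
      simp [pow_two]
    linarith
  have h := lu_diag s d hd (fun k => Uᵀ * C k * U)
    (fun k => by simp only [transpose_mul, transpose_transpose, hs k, Matrix.mul_assoc])
    (fun j k hjk => by rw [ip_conj _ _ _ hU2, horth j k hjk])
    (fun j => by rw [ip_conj _ _ _ hU2]; exact hnorm j) x c hx hc hc0
  convert h using 3 with k hk
  have h3 : Uᵀ * (A * C k - C k * A) * U
      = diagonal d * (Uᵀ * C k * U) - (Uᵀ * C k * U) * diagonal d := by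
    rw [← hD]
    have e1 : ∀ X Y : Matrix (Fin n) (Fin n) ℝ,
        Uᵀ * X * U * (Uᵀ * Y * U) = Uᵀ * (X * Y) * U := by
      intro X Y
      simp only [Matrix.mul_assoc]
      rw [← Matrix.mul_assoc U Uᵀ, hU2, Matrix.one_mul]
    rw [e1, e1, Matrix.mul_sub, Matrix.sub_mul]
  rw [nc, ← ip_conj U _ _ hU2, h3, ip]
  refine Finset.sum_congr rfl fun i _ => Finset.sum_congr rfl fun j _ => ?_
  rw [Matrix.sub_apply, Matrix.diagonal_mul, Matrix.mul_diagonal]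
  ring

theorem rot_sq {m : ℕ} (V : Matrix (Fin m) (Fin m) ℝ) (hV : V * Vᵀ = 1) (u : Fin m → ℝ) :
    ∑ j, (∑ k, V k j * u k) ^ 2 = ∑ k, u k ^ 2 := by
  have hV' : ∀ k l, ∑ j, V k j * V l j = if k = l then 1 else 0 := by
    intro k l
    have := congrFun (congrFun hV k) l
    rwa [Matrix.mul_apply, Matrix.one_apply] at this
  simp only [pow_two, Finset.sum_mul_sum]
  rw [Finset.sum_comm]
  refine Finset.sum_congr rfl fun k _ => ?_
  rw [Finset.sum_comm]
  have : ∀ l, ∑ j, V k j * u k * (V l j * u l) = (if k = l then 1 else 0) * (u k * u l) := by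
    intro l
    rw [← hV', Finset.sum_mul]
    exact Finset.sum_congr rfl fun j _ => by ring
  simp only [this]
  simp

theorem rot_lin {n m : ℕ} (V : Matrix (Fin m) (Fin m) ℝ) (hV : V * Vᵀ = 1)
    (B : Fin m → Matrix (Fin n) (Fin n) ℝ) (f : Matrix (Fin n) (Fin n) ℝ →ₗ[ℝ] ℝ) :
    ∑ j, (f (∑ k, V k j • B k)) ^ 2 = ∑ k, (f (B k)) ^ 2 := by
  rw [← rot_sq V hV (fun k => f (B k))]
  simp only [map_sum, map_smul, smul_eq_mul]

theorem rot_ip {n m : ℕ} (V : Matrix (Fin m) (Fin m) ℝ) (hV : V * Vᵀ = 1)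
    (B : Fin m → Matrix (Fin n) (Fin n) ℝ)
    (L : Matrix (Fin n) (Fin n) ℝ →ₗ[ℝ] Matrix (Fin n) (Fin n) ℝ) :
    ∑ j, ip (L (∑ k, V k j • B k)) (L (∑ k, V k j • B k)) = ∑ k, ip (L (B k)) (L (B k)) := by
  simp only [ip, ← pow_two]
  rw [Finset.sum_comm]
  conv_rhs => rw [Finset.sum_comm]
  refine Finset.sum_congr rfl fun a _ => ?_
  rw [Finset.sum_comm]
  conv_rhs => rw [Finset.sum_comm]
  refine Finset.sum_congr rfl fun b _ => ?_
  exact rot_lin V hV B ((Matrix.entryLinearMap ℝ ℝ a b).comp L)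

theorem rot_nc {n m : ℕ} (V : Matrix (Fin m) (Fin m) ℝ) (hV : V * Vᵀ = 1)
    (B : Fin m → Matrix (Fin n) (Fin n) ℝ) (X : Matrix (Fin n) (Fin n) ℝ) :
    ∑ j, nc X (∑ k, V k j • B k) = ∑ k, nc X (B k) :=
  rot_ip V hV B (LinearMap.mulLeft ℝ X - LinearMap.mulRight ℝ X)

theorem ip_comm {n : ℕ} (A B : Matrix (Fin n) (Fin n) ℝ) : ip A B = ip B A := by
  simp only [ip, mul_comm]

/-- `ip X` as a linear map. -/
noncomputable def ipL {n : ℕ} (X : Matrix (Fin n) (Fin n) ℝ) : Matrix (Fin n) (Fin n) ℝ →ₗ[ℝ] ℝ where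
  toFun Y := ip X Y
  map_add' Y Z := by simp only [ip, Matrix.add_apply, mul_add, Finset.sum_add_distrib]
  map_smul' a Y := by
    simp only [ip, Matrix.smul_apply, smul_eq_mul, Finset.mul_sum, RingHom.id_apply]
    refine Finset.sum_congr rfl fun i _ => Finset.sum_congr rfl fun j _ => by ring

theorem ip_smul {n : ℕ} (a b : ℝ) (A B : Matrix (Fin n) (Fin n) ℝ) :
    ip (a • A) (b • B) = a * b * ip A B := by
  simp only [ip, Matrix.smul_apply, smul_eq_mul, Finset.mul_sum]
  refine Finset.sum_congr rfl fun i _ => Finset.sum_congr rfl fun j _ => by ring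

theorem ip_self_nonneg {n : ℕ} (A : Matrix (Fin n) (Fin n) ℝ) : 0 ≤ ip A A :=
  Finset.sum_nonneg fun _ _ => Finset.sum_nonneg fun _ _ => mul_self_nonneg _

theorem ip_self_eq_zero {n : ℕ} (A : Matrix (Fin n) (Fin n) ℝ) (h : ip A A = 0) : A = 0 := by
  ext i j
  have h1 := (Finset.sum_eq_zero_iff_of_nonneg
    (fun i _ => Finset.sum_nonneg fun j _ => mul_self_nonneg (A i j))).mp h i (Finset.mem_univ _)
  have h2 := (Finset.sum_eq_zero_iff_of_nonneg
    (fun j _ => mul_self_nonneg (A i j))).mp h1 j (Finset.mem_univ _)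
  simpa using h2

/-- The case of mutually orthogonal matrices. -/
theorem orth_case {n m : ℕ} (B : Fin m → Matrix (Fin n) (Fin n) ℝ) (hs : ∀ j, (B j)ᵀ = B j)
    (horth : ∀ j k, j ≠ k → ip (B j) (B k) = 0) :
    ∑ j, ∑ k, nc (B j) (B k) + ∑ j, (ip (B j) (B j)) ^ 2
      ≤ (3 / 2) * (∑ j, ip (B j) (B j)) ^ 2 := by
  let r : Fin m → ℝ := fun j => √(ip (B j) (B j))
  let A : Fin m → Matrix (Fin n) (Fin n) ℝ := fun j => (r j)⁻¹ • B j
  have hr2 : ∀ j, r j ^ 2 = ip (B j) (B j) := fun j => Real.sq_sqrt (ip_self_nonneg _)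
  have hBA : ∀ j, B j = r j • A j := by
    intro j
    by_cases h : r j = 0
    · have : B j = 0 := ip_self_eq_zero _ (by rw [← hr2, h]; norm_num)
      rw [h, zero_smul, this]
    · simp only [A]; rw [smul_smul, mul_inv_cancel₀ h, one_smul]
  have hAs : ∀ j, (A j)ᵀ = A j := fun j => by simp only [A, transpose_smul, hs]
  have hAo : ∀ j k, j ≠ k → ip (A j) (A k) = 0 := fun j k hjk => by
    simp only [A]; rw [ip_smul, horth j k hjk, mul_zero]
  have hAn : ∀ j, ip (A j) (A j) ≤ 1 := fun j => by
    simp only [A]; rw [ip_smul, ← hr2]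
    by_cases h : r j = 0
    · rw [h]; norm_num
    · apply le_of_eq; field_simp
  let M : Fin m → Fin m → ℝ := fun j k => nc (A j) (A k) + (if j = k then 1 else 0) - 3 / 2
  have hM : ∀ i j, M i j = M j i := fun i j => by
    simp only [M]; rw [nc_comm]; simp only [eq_comm]
  have hMx : ∀ (x : Fin m → ℝ) j, ∑ k, M j k * x k
      = ∑ k, x k * nc (A j) (A k) + x j - 3 / 2 * ∑ k, x k := by
    intro x j
    simp only [M, add_mul, sub_mul, Finset.sum_add_distrib, Finset.sum_sub_distrib, Finset.mul_sum]
    simp [mul_comm]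
  have hcond : ∀ x : Fin m → ℝ, (∀ i, 0 ≤ x i) → ∀ j, (∀ k, x k ≤ x j) →
      ∑ k, M j k * x k ≤ 0 := by
    intro x hx j hj
    rw [hMx]
    have hsum : ∑ k ∈ Finset.univ.erase j, x k + x j = ∑ k, x k :=
      Finset.sum_erase_add _ _ (Finset.mem_univ _)
    have hl := lu_lemma (Finset.univ.erase j) (A j) (hAs j) (hAn j) A hAs hAo hAn x
      ((∑ k, x k) / 2) (fun k _ => hx k)
      (fun k hk => by
        have h1 : x k ≤ ∑ k ∈ Finset.univ.erase j, x k :=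
          Finset.single_le_sum (fun i _ => hx i) hk
        have h2 := hj k
        linarith)
      (div_nonneg (Finset.sum_nonneg fun i _ => hx i) (by norm_num))
    have hsum2 : ∑ k ∈ Finset.univ.erase j, x k * nc (A j) (A k) + x j * nc (A j) (A j)
        = ∑ k, x k * nc (A j) (A k) := Finset.sum_erase_add _ _ (Finset.mem_univ _)
    have h0 : nc (A j) (A j) = 0 := by simp [nc, ip]
    rw [h0, mul_zero, add_zero] at hsum2
    linarith
  have hfin := layer_aux M hM hcond _ (fun j => r j ^ 2) (fun j => sq_nonneg _) le_rfl
  simp only [hMx] at hfin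
  have hN : ∀ j k, nc (B j) (B k) = r j ^ 2 * (r k ^ 2 * nc (A j) (A k)) := by
    intro j k
    conv_lhs => rw [hBA j, hBA k, nc_smul]
    ring
  simp only [hN, ← hr2]
  simp only [mul_add, mul_sub, Finset.sum_add_distrib, Finset.sum_sub_distrib, ← Finset.sum_mul,
    ← Finset.mul_sum] at hfin ⊢
  have e1 : ∑ j, (r j ^ 2) ^ 2 = ∑ j, r j ^ 2 * r j ^ 2 :=
    Finset.sum_congr rfl fun j _ => by ring
  rw [e1]
  nlinarith

theorem liLi_ip {n m : ℕ} (B : Fin m → Matrix (Fin n) (Fin n) ℝ) (hs : ∀ j, (B j)ᵀ = B j) :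
    ∑ j, ∑ k, nc (B j) (B k) + ∑ j, ∑ k, (ip (B j) (B k)) ^ 2
      ≤ (3 / 2) * (∑ j, ip (B j) (B j)) ^ 2 := by
  let G : Matrix (Fin m) (Fin m) ℝ := fun j k => ip (B j) (B k)
  have hG : Gᵀ = G := by ext j k; exact ip_comm _ _
  obtain ⟨V, d, hV1, hV2, hVd⟩ := spec_aux G hG
  let B' : Fin m → Matrix (Fin n) (Fin n) ℝ := fun j => ∑ k, V k j • B k
  have hs' : ∀ j, (B' j)ᵀ = B' j := fun j => by
    simp only [B', transpose_sum, transpose_smul, hs]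
  have hgram : ∀ j k, ip (B' j) (B' k) = (Vᵀ * G * V) j k := by
    intro j k
    have h1 : ∀ X, ip X (B' k) = ∑ l, V l k * ip X (B l) := by
      intro X
      change ipL X (B' k) = ∑ l, V l k * ipL X (B l)
      simp only [B', map_sum, map_smul, smul_eq_mul]
    have h2 : ∀ X, ip (B' j) X = ∑ l, V l j * ip (B l) X := by
      intro X
      rw [ip_comm]
      change ipL X (B' j) = _
      simp only [B', map_sum, map_smul, smul_eq_mul]
      exact Finset.sum_congr rfl fun l _ => by rw [ip_comm]; rfl
    rw [h1, Matrix.mul_apply]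
    refine Finset.sum_congr rfl fun l _ => ?_
    rw [h2, Matrix.mul_apply, mul_comm]
    rfl
  have hD : Vᵀ * G * V = diagonal d := by
    rw [hVd]
    simp only [Matrix.mul_assoc]
    rw [hV1, Matrix.mul_one, ← Matrix.mul_assoc, hV1, Matrix.one_mul]
  have horth : ∀ j k, j ≠ k → ip (B' j) (B' k) = 0 := fun j k hjk => by
    rw [hgram, hD, diagonal_apply_ne _ hjk]
  have h := orth_case B' hs' horth
  have i1 : ∑ j, ∑ k, nc (B' j) (B' k) = ∑ j, ∑ k, nc (B j) (B k) := by
    calc _ = ∑ j, ∑ k, nc (B' j) (B k) := Finset.sum_congr rfl fun j _ => rot_nc V hV2 B _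
      _ = ∑ k, ∑ j, nc (B k) (B' j) := by
        rw [Finset.sum_comm]
        exact Finset.sum_congr rfl fun _ _ => Finset.sum_congr rfl fun _ _ => nc_comm _ _
      _ = _ := Finset.sum_congr rfl fun j _ => rot_nc V hV2 B _
  have rotS : ∀ X, ∑ k, (ip X (B' k)) ^ 2 = ∑ k, (ip X (B k)) ^ 2 :=
    fun X => rot_lin V hV2 B (ipL X)
  have i2 : ∑ j, ∑ k, (ip (B' j) (B' k)) ^ 2 = ∑ j, ∑ k, (ip (B j) (B k)) ^ 2 := by
    calc _ = ∑ j, ∑ k, (ip (B' j) (B k)) ^ 2 := Finset.sum_congr rfl fun j _ => rotS _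
      _ = ∑ k, ∑ j, (ip (B k) (B' j)) ^ 2 := by
        rw [Finset.sum_comm]
        exact Finset.sum_congr rfl fun _ _ => Finset.sum_congr rfl fun _ _ => by rw [ip_comm]
      _ = _ := Finset.sum_congr rfl fun j _ => rotS _
  have i2' : ∑ j, ∑ k, (ip (B' j) (B' k)) ^ 2 = ∑ j, (ip (B' j) (B' j)) ^ 2 := by
    refine Finset.sum_congr rfl fun j _ => ?_
    rw [Finset.sum_eq_single_of_mem j (Finset.mem_univ _)]
    intro k _ hk
    rw [horth j k hk.symm]; norm_num
  have i3 : ∑ j, ip (B' j) (B' j) = ∑ j, ip (B j) (B j) := rot_ip V hV2 B LinearMap.id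
  rw [i1, ← i2', i2, i3] at h
  exact h



/-- Li–Li algebraic inequality: for symmetric real `n × n` matrices `B 1, …, B m` (`m ≥ 2`),
with `S_{jk} = trace (B j * B k)`, `N C = trace (Cᵀ * C)` and `S = Σ_j S_{jj}`, one has
`Σ_{j,k} N (B j * B k - B k * B j) + Σ_{j,k} S_{jk}² ≤ (3/2) S²`. -/
theorem liLi_inequality (n m : ℕ) (hn : 1 ≤ n) (hm : 2 ≤ m)
    (B : Fin m → Matrix (Fin n) (Fin n) ℝ)
    (hsymm : ∀ j, (B j)ᵀ = B j) :
    (∑ j, ∑ k, ((B j * B k - B k * B j)ᵀ * (B j * B k - B k * B j)).trace)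
      + ∑ j, ∑ k, ((B j * B k).trace) ^ 2
      ≤ (3 / 2) * (∑ j, (B j * B j).trace) ^ 2 := by
  have h := liLi_ip B hsymm
  simp only [nc, ip_eq, hsymm] at h
  exact h
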